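/- Let p be prime, t := 1/p, and (r_N)_{N≥1} a sequence of positive integers with r_N → ∞. For a positive integer D, let A_{N,D} be the top-left N×N submatrix of a Haar-distributed element of GL_{N+D}(ℤ_p), let X_{N,D} := corank of A_{N,D} mod p over 𝔽_p, and define c_{N,D} := t^{−r_N} / E[1(X_{N,D} ≤ r_N)·(t^{−X_{N,D}} − 1)]. Then c_{N,D}·(1 − t^D)·t^{r_N} → 1 as N → ∞, uniformly in D: for every ε > 0 there is N_0 such that |c_{N,D}(1 − t^D)t^{r_N} − 1| < ε for all N ≥ N_0 and all positive integers D. Moreover, if instead A_N ∈ Mat_N(ℤ_p) has iid entries distributed by the additive Haar probability measure on ℤ_p and c_N is defined analogously, then c_N·t^{r_N} → 1 as N → ∞. -/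

import Mathlib

/-!
Statement 19 (Lemma `compute_c_N`): with `t = 1/p` and `r_N → ∞`, for `A_{N,D}` the
top-left `N × N` corner of a Haar element of `GL_{N+D}(ℤ_p)`, `X_{N,D}` its mod-`p`
corank, and `c_{N,D} = t^{−r_N}/E[1(X_{N,D} ≤ r_N)(t^{−X_{N,D}} − 1)]`, one has
`c_{N,D}·(1 − t^D)·t^{r_N} → 1` uniformly in `D ≥ 1`; and for `A_N` with iid additive
Haar entries, the analogous `c_N` satisfies `c_N·t^{r_N} → 1`.  Haar measures are encoded
as invariant probability measures on the corresponding matrix spaces.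
-/

open MeasureTheory Filter

noncomputable section

instance padicMS (p : ℕ) [Fact p.Prime] : MeasurableSpace ℤ_[p] := borel _

instance matrixMS (p n m : ℕ) [Fact p.Prime] :
    MeasurableSpace (Matrix (Fin n) (Fin m) ℤ_[p]) :=
  inferInstanceAs (MeasurableSpace (Fin n → Fin m → ℤ_[p]))

/-- The mod-`p` corank of the top-left `N × N` submatrix of an `(N+D) × (N+D)` matrix
over `ℤ_p`. -/
def corankTL (p N D : ℕ) [Fact p.Prime] (M : Matrix (Fin (N + D)) (Fin (N + D)) ℤ_[p]) : ℕ :=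
  N - ((M.submatrix (Fin.castLE (Nat.le_add_right N D)) (Fin.castLE (Nat.le_add_right N D))
    : Matrix (Fin N) (Fin N) ℤ_[p]).map PadicInt.toZMod).rank

section LinearAlgebra

variable {K V W : Type*} [Field K] [AddCommGroup V] [Module K V] [AddCommGroup W] [Module K W]

theorem LinearIndependent.exists_linearEquiv_apply_eq [FiniteDimensional K V] {ι : Type*}
    {v w : ι → V} (hv : LinearIndependent K v) (hw : LinearIndependent K w) :
    ∃ g : V ≃ₗ[K] V, ∀ i, g (v i) = w i := by
  let bv := Module.Basis.span hv
  let bw := Module.Basis.span hw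
  obtain ⟨g, hg⟩ := Submodule.exists_linearEquiv_restrict_eq (bv.equiv bw (Equiv.refl ι))
  refine ⟨g, fun i => ?_⟩
  have h := hg (bv i)
  rw [Module.Basis.equiv_apply] at h
  simpa [bv, bw, Module.Basis.span_apply] using h.symm

theorem LinearIndependent.exists_linearMap_apply_eq {ι : Type*}
    {v : ι → V} (hv : LinearIndependent K v) (w : ι → W) :
    ∃ g : V →ₗ[K] W, ∀ i, g (v i) = w i := by
  let bv := Module.Basis.span hv
  obtain ⟨g, hg⟩ := LinearMap.exists_extend (bv.constr K w)
  refine ⟨g, fun i => ?_⟩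
  have h := congrArg (fun f => f (bv i)) hg
  rw [LinearMap.comp_apply, Module.Basis.constr_basis] at h
  simpa [bv, Module.Basis.span_apply] using h

/-- Number of linearly independent `k`-tuples in a subspace of a finite vector space. -/
theorem natCard_linearIndependent_mem [Finite K] [Finite V] (U : Submodule K V) (k : ℕ) :
    (Nat.card {v : Fin k → V // LinearIndependent K v ∧ ∀ i, v i ∈ U} : ℝ) =
      ∏ i ∈ Finset.range k, ((Nat.card K : ℝ) ^ Module.finrank K U - (Nat.card K : ℝ) ^ i) := by
  have := Fintype.ofFinite K
  have e : {v : Fin k → V // LinearIndependent K v ∧ ∀ i, v i ∈ U} ≃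
      {s : Fin k → U // LinearIndependent K s} :=
    { toFun := fun v => ⟨fun i => ⟨v.1 i, v.2.2 i⟩,
        LinearIndependent.of_comp U.subtype v.2.1⟩
      invFun := fun s => ⟨fun i => s.1 i,
        s.2.map' U.subtype U.ker_subtype, fun i => (s.1 i).2⟩
      left_inv := fun v => rfl
      right_inv := fun s => rfl }
  rw [Nat.card_congr e]
  by_cases hk : k ≤ Module.finrank K U
  · rw [card_linearIndependent hk, Fin.prod_univ_eq_prod_range
      (fun i => Fintype.card K ^ Module.finrank K U - Fintype.card K ^ i), Nat.cast_prod]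
    refine Finset.prod_congr rfl fun i hi => ?_
    rw [Nat.cast_sub (Nat.pow_le_pow_right Fintype.card_pos
      ((Finset.mem_range.1 hi).le.trans hk))]
    simp
  · rw [Finset.prod_eq_zero (Finset.mem_range.2 (not_le.1 hk)) (by simp)]
    have : IsEmpty {s : Fin k → U // LinearIndependent K s} :=
      ⟨fun s => hk (by simpa using s.2.fintype_card_le_finrank)⟩
    simp

end LinearAlgebra

section Uniform

variable {Ω Y : Type*} [MeasurableSpace Ω] {μ : Measure Ω} [IsProbabilityMeasure μ]

/-- A random variable that takes values in `T` and hits any two points of `T` with the same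
probability is uniform on `T`. -/
theorem measureReal_preimage_eq_div_of_const [Finite Y] {φ : Ω → Y}
    (hφ : ∀ y, MeasurableSet (φ ⁻¹' {y})) {T S : Set Y} (hT : μ (φ ⁻¹' T) = 1)
    (hconst : ∀ x ∈ T, ∀ y ∈ T, μ.real (φ ⁻¹' {x}) = μ.real (φ ⁻¹' {y})) (hS : S ⊆ T) :
    μ.real (φ ⁻¹' S) = Nat.card S / Nat.card T := by
  classical
  have := Fintype.ofFinite Y
  have hsum (S : Set Y) : μ.real (φ ⁻¹' S) = ∑ y ∈ S.toFinset, μ.real (φ ⁻¹' {y}) := by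
    have : φ ⁻¹' S = ⋃ y ∈ S.toFinset, φ ⁻¹' {y} := by ext; simp
    rw [this, measureReal_biUnion_finset]
    · intro a _ b _ hab
      exact Disjoint.preimage φ (by simpa using hab)
    · exact fun y _ => hφ y
  have hT' : μ.real (φ ⁻¹' T) = 1 := by simp [measureReal_def, hT]
  obtain ⟨x, hx⟩ : T.Nonempty := by
    by_contra h
    rw [Set.not_nonempty_iff_eq_empty.1 h] at hT
    simp at hT
  have hcard (S : Set Y) (hS : S ⊆ T) :
      μ.real (φ ⁻¹' S) = Nat.card S * μ.real (φ ⁻¹' {x}) := by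
    rw [hsum, Finset.sum_congr rfl fun y hy => hconst y (hS (by simpa using hy)) x hx]
    simp [Set.toFinset_card]
  have hTx := hcard T subset_rfl
  rw [hT'] at hTx
  have hne : (Nat.card T : ℝ) ≠ 0 := fun h => by rw [h, zero_mul] at hTx; exact one_ne_zero hTx
  rw [hcard S hS, eq_div_iff hne, mul_assoc, mul_comm (μ.real _), ← hTx, mul_one]

/-- Invariance of `μ` under `f` turns an equality of events up to `f` into an equality of
probabilities. -/
theorem measureReal_preimage_of_map_eq {f : Ω → Ω} (hf : μ.map f = μ) {s : Set Ω}
    (hs : MeasurableSet s) : μ.real (f ⁻¹' s) = μ.real s := by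
  have hae : AEMeasurable f μ :=
    aemeasurable_of_map_neZero (by rw [hf]; infer_instance)
  conv_rhs => rw [← hf]
  rw [measureReal_def, measureReal_def, Measure.map_apply_of_aemeasurable hae hs]

end Uniform

section Moments

variable {K Ω : Type*} [Field K] [Finite K] [MeasurableSpace Ω] {μ : Measure Ω}
  [IsProbabilityMeasure μ] {N : ℕ}

/-- The `k`-th falling moment of the size of the kernel of a random matrix counts the linearly
independent `k`-tuples it annihilates. -/
theorem integral_prod_corank {A : Ω → Matrix (Fin N) (Fin N) K}
    (hA : ∀ S, MeasurableSet (A ⁻¹' S)) {k : ℕ} {q : ℝ}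
    (hq : ∀ v : Fin k → Fin N → K, LinearIndependent K v →
      μ.real {ω | ∀ i, (A ω).mulVec (v i) = 0} = q) :
    ∫ ω, ∏ i ∈ Finset.range k, ((Nat.card K : ℝ) ^ (N - (A ω).rank) - (Nat.card K : ℝ) ^ i) ∂μ =
      (∏ i ∈ Finset.range k, ((Nat.card K : ℝ) ^ N - (Nat.card K : ℝ) ^ i)) * q := by
  classical
  have := Fintype.ofFinite K
  have hker (M : Matrix (Fin N) (Fin N) K) :
      Module.finrank K (LinearMap.ker M.mulVecLin) = N - M.rank := by
    have := LinearMap.finrank_range_add_finrank_ker M.mulVecLin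
    rw [Module.finrank_fintype_fun_eq_card, Fintype.card_fin] at this
    rw [Matrix.rank]
    omega
  have hpt (ω : Ω) :
      ∏ i ∈ Finset.range k, ((Nat.card K : ℝ) ^ (N - (A ω).rank) - (Nat.card K : ℝ) ^ i) =
      ∑ v : {v : Fin k → Fin N → K // LinearIndependent K v},
        {ω | ∀ i, (A ω).mulVec (v.1 i) = 0}.indicator (fun _ => (1 : ℝ)) ω := by
    rw [← hker, ← natCard_linearIndependent_mem,
      Nat.card_congr (Equiv.subtypeSubtypeEquivSubtypeInter _ _).symm]
    simp only [Set.indicator_apply, Finset.sum_boole, Set.mem_ofPred_eq, LinearMap.mem_ker,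
      Matrix.mulVecLin_apply, Nat.card_eq_fintype_card, Fintype.card_subtype]
  have hmeas (v : Fin k → Fin N → K) : MeasurableSet {ω | ∀ i, (A ω).mulVec (v i) = 0} :=
    hA {M | ∀ i, M.mulVec (v i) = 0}
  simp_rw [hpt]
  rw [integral_finsetSum _ fun v _ => (integrable_const _).indicator (hmeas v.1)]
  simp_rw [integral_indicator_const (1 : ℝ) (hmeas _)]
  rw [Finset.sum_congr rfl fun v _ => by rw [hq v.1 v.2]]
  have hc := natCard_linearIndependent_mem (⊤ : Submodule K (Fin N → K)) k
  simp only [Submodule.mem_top, implies_true, and_true, finrank_top,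
    Module.finrank_fintype_fun_eq_card, Fintype.card_fin] at hc
  rw [← hc]
  simp

/-- The truncated first moment differs from the full one by at most `p ^ (-r)` as soon as the
second falling moment is at most one. -/
theorem integral_truncated_mem_Icc {p r : ℕ} (hp : 2 ≤ p) (hr : 1 ≤ r) {x : Ω → ℕ}
    (hx : ∀ S, MeasurableSet (x ⁻¹' S)) (hxN : ∀ ω, x ω ≤ N)
    (h2 : ∫ ω, ∏ i ∈ Finset.range 2, ((p : ℝ) ^ x ω - (p : ℝ) ^ i) ∂μ ≤ 1) :
    ∫ ω, (if x ω ≤ r then (1 / p : ℝ) ^ (-(x ω : ℤ)) - 1 else 0) ∂μ ∈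
      Set.Icc (∫ ω, ∏ i ∈ Finset.range 1, ((p : ℝ) ^ x ω - (p : ℝ) ^ i) ∂μ - (1 / p : ℝ) ^ r)
        (∫ ω, ∏ i ∈ Finset.range 1, ((p : ℝ) ^ x ω - (p : ℝ) ^ i) ∂μ) := by
  have hp' : (2 : ℝ) ≤ p := by exact_mod_cast hp
  have hint (f : ℕ → ℝ) : Integrable (fun ω => f (x ω)) μ := by
    refine Integrable.of_bound (C := ∑ i ∈ Finset.range (N + 1), |f i|) ?_ ?_
    · exact (measurable_from_top.comp (g := f) (fun S _ => hx S)).aestronglyMeasurable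
    · refine Eventually.of_forall fun ω => ?_
      exact Finset.single_le_sum (f := fun i => |f i|) (fun i _ => abs_nonneg _)
        (Finset.mem_range.2 (Nat.lt_succ_of_le (hxN ω)))
  have hI := hint fun n => if n ≤ r then (1 / p : ℝ) ^ (-(n : ℤ)) - 1 else 0
  have hI1 := hint fun n => ∏ i ∈ Finset.range 1, ((p : ℝ) ^ n - (p : ℝ) ^ i)
  have hI2 := hint fun n => ∏ i ∈ Finset.range 2, ((p : ℝ) ^ n - (p : ℝ) ^ i)
  have hpow (n : ℕ) : (1 / p : ℝ) ^ (-(n : ℤ)) = (p : ℝ) ^ n := by simp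
  have hone (n : ℕ) : (1 : ℝ) ≤ (p : ℝ) ^ n := one_le_pow₀ (by linarith)
  constructor
  · have hle : ∫ ω, (∏ i ∈ Finset.range 1, ((p : ℝ) ^ x ω - (p : ℝ) ^ i) -
        (1 / p : ℝ) ^ r * ∏ i ∈ Finset.range 2, ((p : ℝ) ^ x ω - (p : ℝ) ^ i)) ∂μ ≤
        ∫ ω, (if x ω ≤ r then (1 / p : ℝ) ^ (-(x ω : ℤ)) - 1 else 0) ∂μ := by
      refine integral_mono (hI1.sub (hI2.const_mul _)) hI fun ω => ?_
      simp only [Finset.prod_range_succ, Finset.range_zero, Finset.prod_empty, one_mul, pow_zero,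
        pow_one, hpow]
      have htr : (1 / p : ℝ) ^ r * (p : ℝ) ^ r = 1 := by
        rw [← mul_pow]; field_simp; simp
      have htpos : 0 < (1 / p : ℝ) ^ r := by positivity
      have h1 := hone (x ω)
      split_ifs with h
      · have : 0 ≤ ((p : ℝ) ^ x ω - 1) * ((p : ℝ) ^ x ω - p) := by
          rcases Nat.eq_zero_or_pos (x ω) with h0 | h0
          · simp [h0]
          · exact mul_nonneg (by linarith)
              (sub_nonneg.2 (le_self_pow₀ (by linarith) h0.ne'))
        nlinarith
      · have hpr : (p : ℝ) ≤ p ^ r := le_self_pow₀ (by linarith) (by omega)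
        have hpx : (p : ℝ) ^ (r + 1) ≤ p ^ x ω := pow_le_pow_right₀ (by linarith) (by omega)
        have hkey : (p : ℝ) ^ r ≤ p ^ x ω - p := by
          rw [pow_succ] at hpx
          nlinarith
        have : 1 ≤ (1 / p : ℝ) ^ r * ((p : ℝ) ^ x ω - p) := by
          exact htr.ge.trans (mul_le_mul_of_nonneg_left hkey htpos.le)
        nlinarith
    rw [integral_sub hI1 (hI2.const_mul _), integral_const_mul] at hle
    refine le_trans ?_ hle
    have htpos : 0 < (1 / p : ℝ) ^ r := by positivity
    nlinarith
  · refine integral_mono hI hI1 fun ω => ?_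
    simp only [Finset.prod_range_succ, Finset.range_zero, Finset.prod_empty, one_mul, pow_zero,
      hpow]
    split_ifs
    · rfl
    · linarith [hone (x ω)]

end Moments

section Reduction

variable {p : ℕ} [Fact p.Prime]

theorem PadicInt.toZMod_eq_zero_iff {x : ℤ_[p]} : PadicInt.toZMod x = 0 ↔ ‖x‖ < 1 := by
  rw [← RingHom.mem_ker, PadicInt.ker_toZMod, IsLocalRing.mem_maximalIdeal, PadicInt.mem_nonunits]

theorem PadicInt.isUnit_iff_toZMod_ne_zero {x : ℤ_[p]} : IsUnit x ↔ PadicInt.toZMod x ≠ 0 := by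
  rw [← not_iff_not, not_not, ← mem_nonunits_iff, PadicInt.mem_nonunits,
    PadicInt.toZMod_eq_zero_iff]

theorem Matrix.isUnit_det_iff_map_toZMod {n : ℕ} (M : Matrix (Fin n) (Fin n) ℤ_[p]) :
    IsUnit M.det ↔ IsUnit (M.map PadicInt.toZMod).det := by
  rw [PadicInt.isUnit_iff_toZMod_ne_zero, RingHom.map_det, isUnit_iff_ne_zero]
  rfl

theorem measurableSet_toZMod_eq (a : ZMod p) :
    MeasurableSet {x : ℤ_[p] | PadicInt.toZMod x = a} := by
  have : BorelSpace ℤ_[p] := ⟨rfl⟩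
  refine IsOpen.measurableSet (Metric.isOpen_iff.2 fun x hx => ⟨1, one_pos, fun y hy => ?_⟩)
  rw [Metric.mem_ball, dist_eq_norm, ← PadicInt.toZMod_eq_zero_iff, map_sub, sub_eq_zero] at hy
  exact hy.trans hx

theorem measurableSet_preimage_map_toZMod {n m : ℕ} (S : Set (Matrix (Fin n) (Fin m) (ZMod p))) :
    MeasurableSet ((fun M : Matrix (Fin n) (Fin m) ℤ_[p] => M.map PadicInt.toZMod) ⁻¹' S) := by
  have : (fun M : Matrix (Fin n) (Fin m) ℤ_[p] => M.map PadicInt.toZMod) ⁻¹' S =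
      ⋃ B ∈ S, ⋂ i, ⋂ j, {M | PadicInt.toZMod (M i j) = B i j} := by
    ext M
    simp only [Set.mem_preimage, Set.mem_iUnion, Set.mem_iInter, Set.mem_ofPred_eq, exists_prop]
    refine ⟨fun h => ⟨_, h, fun i j => rfl⟩, ?_⟩
    rintro ⟨B, hB, h⟩
    have : M.map PadicInt.toZMod = B := Matrix.ext h
    rwa [this]
  rw [this]
  refine MeasurableSet.biUnion S.toFinite.countable fun B _ =>
    MeasurableSet.iInter fun i => MeasurableSet.iInter fun j => ?_
  have hmeas : Measurable fun M : Fin n → Fin m → ℤ_[p] => M i j :=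
    (measurable_pi_apply j).comp (measurable_pi_apply i)
  exact hmeas (measurableSet_toZMod_eq (B i j))

theorem exists_map_toZMod_eq {n m : ℕ} (B : Matrix (Fin n) (Fin m) (ZMod p)) :
    ∃ M : Matrix (Fin n) (Fin m) ℤ_[p], M.map PadicInt.toZMod = B := by
  choose f hf using ZMod.ringHom_surjective (PadicInt.toZMod (p := p))
  exact ⟨B.map f, by ext; simp [hf]⟩

end Reduction

section Haar

variable {p n : ℕ} [Fact p.Prime] {μ : Measure (Matrix (Fin n) (Fin n) ℤ_[p])}
  [IsProbabilityMeasure μ]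

/-- Under an additive Haar matrix, linearly independent `k`-tuples have uniform image. -/
theorem measureReal_mulVec_eq_zero_of_add_invariant
    (hμ : ∀ C : Matrix (Fin n) (Fin n) ℤ_[p], μ.map (fun M => C + M) = μ) {k : ℕ}
    {v : Fin k → Fin n → ZMod p} (hv : LinearIndependent (ZMod p) v) :
    μ.real {M | ∀ i, (M.map PadicInt.toZMod).mulVec (v i) = 0} = 1 / (p : ℝ) ^ (n * k) := by
  let φ : Matrix (Fin n) (Fin n) ℤ_[p] → Fin k → Fin n → ZMod p :=
    fun M i => (M.map PadicInt.toZMod).mulVec (v i)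
  have hφ (y) : MeasurableSet (φ ⁻¹' {y}) :=
    measurableSet_preimage_map_toZMod {B | (fun i => B.mulVec (v i)) = y}
  have h := measureReal_preimage_eq_div_of_const (μ := μ) hφ (T := Set.univ) (S := {0})
    (by simp) ?_ (Set.subset_univ _)
  · have hs : {M | ∀ i, (M.map PadicInt.toZMod).mulVec (v i) = 0} = φ ⁻¹' {0} := by
      ext M; simp [φ, funext_iff]
    rw [hs, h]
    simp [pow_mul]
  · intro x _ y _
    obtain ⟨g, hg⟩ := hv.exists_linearMap_apply_eq (y - x)
    obtain ⟨C, hC⟩ := exists_map_toZMod_eq (LinearMap.toMatrix' g)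
    rw [← measureReal_preimage_of_map_eq (hμ C) (hφ y)]
    congr 1
    ext M
    have hCv (i) : (C.map PadicInt.toZMod).mulVec (v i) = y i - x i := by
      rw [hC, LinearMap.toMatrix'_mulVec, hg, Pi.sub_apply]
    have : φ (C + M) = y - x + φ M := by
      ext1 i
      simp only [φ, Matrix.map_add _ (map_add _), Matrix.add_mulVec, hCv, Pi.add_apply,
        Pi.sub_apply]
    simp only [Set.mem_preimage, Set.mem_singleton_iff, this]
    constructor
    · rintro rfl; simp
    · intro h
      have := eq_sub_of_add_eq' h
      simpa using this

/-- Under a Haar matrix of `GL_n`, the image of a linearly independent `k`-tuple is uniform among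
linearly independent `k`-tuples. -/
theorem measureReal_mulVec_mem_of_mul_invariant
    (hgl : μ {M | IsUnit M.det} = 1)
    (hμ : ∀ U : (Matrix (Fin n) (Fin n) ℤ_[p])ˣ, μ.map (fun M => U.val * M) = μ) {k : ℕ}
    {v : Fin k → Fin n → ZMod p} (hv : LinearIndependent (ZMod p) v)
    (W : Submodule (ZMod p) (Fin n → ZMod p)) :
    μ.real {M | ∀ i, (M.map PadicInt.toZMod).mulVec (v i) ∈ W} =
      (∏ i ∈ Finset.range k, ((p : ℝ) ^ Module.finrank (ZMod p) W - (p : ℝ) ^ i)) /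
        ∏ i ∈ Finset.range k, ((p : ℝ) ^ n - (p : ℝ) ^ i) := by
  let φ : Matrix (Fin n) (Fin n) ℤ_[p] → Fin k → Fin n → ZMod p :=
    fun M i => (M.map PadicInt.toZMod).mulVec (v i)
  let T : Set (Fin k → Fin n → ZMod p) := {w | LinearIndependent (ZMod p) w}
  have hφ (y) : MeasurableSet (φ ⁻¹' {y}) :=
    measurableSet_preimage_map_toZMod {B | (fun i => B.mulVec (v i)) = y}
  have hglT : {M : Matrix (Fin n) (Fin n) ℤ_[p] | IsUnit M.det} ⊆ φ ⁻¹' T := by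
    intro M hM
    have hM' := (Matrix.isUnit_det_iff_map_toZMod M).1 hM
    have hinj := Matrix.mulVec_injective_of_isUnit ((Matrix.isUnit_iff_isUnit_det _).2 hM')
    exact hv.map' (Matrix.mulVecLin (M.map PadicInt.toZMod)) (LinearMap.ker_eq_bot.2 hinj)
  have hT : μ (φ ⁻¹' T) = 1 := le_antisymm prob_le_one (hgl ▸ measure_mono hglT)
  have hTm : MeasurableSet (φ ⁻¹' T) :=
    measurableSet_preimage_map_toZMod {B | LinearIndependent (ZMod p) fun i => B.mulVec (v i)}
  have h := measureReal_preimage_eq_div_of_const (μ := μ) hφ (T := T)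
    (S := {w | LinearIndependent (ZMod p) w ∧ ∀ i, w i ∈ W}) hT ?_ fun w hw => hw.1
  · have hs : μ.real {M | ∀ i, (M.map PadicInt.toZMod).mulVec (v i) ∈ W} =
        μ.real (φ ⁻¹' {w | LinearIndependent (ZMod p) w ∧ ∀ i, w i ∈ W}) := by
      refine measureReal_congr ?_
      have hae : ∀ᵐ M ∂μ, M ∈ φ ⁻¹' T := (mem_ae_iff_prob_eq_one hTm).2 hT
      filter_upwards [hae] with M hM
      refine propext ⟨fun h => ⟨hM, h⟩, fun h => h.2⟩
    rw [hs, h]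
    have h1 := natCard_linearIndependent_mem W k
    have h2 := natCard_linearIndependent_mem (⊤ : Submodule (ZMod p) (Fin n → ZMod p)) k
    simp only [Submodule.mem_top, implies_true, and_true, finrank_top, Nat.card_zmod,
      Module.finrank_fintype_fun_eq_card, Fintype.card_fin] at h1 h2
    rw [← h1, ← h2]
    rfl
  · intro x hx y hy
    obtain ⟨g, hg⟩ := LinearIndependent.exists_linearEquiv_apply_eq hx hy
    obtain ⟨C, hC⟩ := exists_map_toZMod_eq (LinearMap.toMatrix' g.toLinearMap)
    have hCu : IsUnit C := by
      rw [Matrix.isUnit_iff_isUnit_det, Matrix.isUnit_det_iff_map_toZMod, hC,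
        LinearMap.det_toMatrix']
      exact g.isUnit_det'
    obtain ⟨U, rfl⟩ := hCu
    rw [← measureReal_preimage_of_map_eq (hμ U) (hφ y)]
    congr 1
    ext M
    have : φ (U.val * M) = fun i => g (φ M i) := by
      ext1 i
      simp only [φ, Matrix.map_mul, ← Matrix.mulVec_mulVec, hC]
      rw [LinearMap.toMatrix'_mulVec]
      rfl
    simp only [Set.mem_preimage, Set.mem_singleton_iff, this,
      funext_iff (f := φ M), funext_iff (g := y)]
    refine forall_congr' fun i => ?_
    rw [← hg i, g.injective.eq_iff]

end Haar

section Corner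

variable {K : Type*} [Field K] {N D : ℕ}

theorem submatrix_castLE_mulVec {R : Type*} [NonUnitalNonAssocSemiring R]
    (M : Matrix (Fin (N + D)) (Fin (N + D)) R)
    (v : Fin N → R) :
    (M.submatrix (Fin.castLE (Nat.le_add_right N D)) (Fin.castLE (Nat.le_add_right N D))).mulVec v =
      fun i => M.mulVec (Fin.append v 0) (Fin.castAdd D i) := by
  ext i
  simp only [Matrix.mulVec, dotProduct, Fin.sum_univ_add, Fin.append_left, Fin.append_right,
    Pi.zero_apply, mul_zero, Finset.sum_const_zero, add_zero, Matrix.submatrix_apply]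
  rfl

theorem LinearIndependent.append_zero {ι : Type*} {v : ι → Fin N → K} (hv : LinearIndependent K v) :
    LinearIndependent K fun i => (Fin.append (v i) 0 : Fin (N + D) → K) := by
  refine LinearIndependent.of_comp (LinearMap.funLeft K K (Fin.castAdd D)) ?_
  convert hv using 2 with i
  ext j
  simp [LinearMap.funLeft_apply]

theorem finrank_ker_funLeft_castAdd :
    Module.finrank K (LinearMap.ker (LinearMap.funLeft K K (Fin.castAdd D (n := N)))) = D := by
  have h := LinearMap.finrank_range_add_finrank_ker (LinearMap.funLeft K K (Fin.castAdd D (n := N)))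
  rw [LinearMap.range_eq_top.2 (LinearMap.funLeft_surjective_of_injective K K _
    (Fin.castAdd_injective N D)), finrank_top, Module.finrank_fintype_fun_eq_card,
    Module.finrank_fintype_fun_eq_card, Fintype.card_fin, Fintype.card_fin] at h
  omega

theorem measureReal_corner_mulVec_eq_zero {p : ℕ} [Fact p.Prime]
    {μ : Measure (Matrix (Fin (N + D)) (Fin (N + D)) ℤ_[p])} [IsProbabilityMeasure μ]
    (hgl : μ {M | IsUnit M.det} = 1)
    (hμ : ∀ U : (Matrix (Fin (N + D)) (Fin (N + D)) ℤ_[p])ˣ, μ.map (fun M => U.val * M) = μ)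
    {k : ℕ} {v : Fin k → Fin N → ZMod p} (hv : LinearIndependent (ZMod p) v) :
    μ.real {M | ∀ i, ((M.submatrix (Fin.castLE (Nat.le_add_right N D))
        (Fin.castLE (Nat.le_add_right N D))).map PadicInt.toZMod).mulVec (v i) = 0} =
      (∏ i ∈ Finset.range k, ((p : ℝ) ^ D - (p : ℝ) ^ i)) /
        ∏ i ∈ Finset.range k, ((p : ℝ) ^ (N + D) - (p : ℝ) ^ i) := by
  have h := measureReal_mulVec_mem_of_mul_invariant hgl hμ (hv.append_zero (D := D))
    (LinearMap.ker (LinearMap.funLeft _ _ (Fin.castAdd D)))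
  rw [finrank_ker_funLeft_castAdd] at h
  rw [← h]
  congr 1
  ext M
  simp only [Set.mem_ofPred_eq, LinearMap.mem_ker]
  refine forall_congr' fun i => ?_
  rw [← Matrix.submatrix_map, submatrix_castLE_mulVec]
  rfl

end Corner

/-- Elementary squeeze: if `I / a` lies in `[1 - s, 1]`, then `a / I` is close to one. -/
theorem abs_div_sub_one_lt {a I s ε : ℝ} (ha : 0 < a) (hlow : a * (1 - s) ≤ I) (hup : I ≤ a)
    (hs : s < 1) (hsε : 1 / (1 - s) < 1 + ε) : |a / I - 1| < ε := by
  have hI : 0 < I := lt_of_lt_of_le (mul_pos ha (by linarith)) hlow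
  have h1 : 1 ≤ a / I := (one_le_div hI).2 hup
  have h2 : a / I ≤ 1 / (1 - s) := by
    rw [div_le_div_iff₀ hI (by linarith)]
    linarith
  rw [abs_lt]
  constructor <;> linarith

theorem statement19 (p : ℕ) [Fact p.Prime] (t : ℝ) (ht : t = 1 / p)
    (r : ℕ → ℕ) (hr1 : ∀ N, 1 ≤ r N) (hr : Tendsto r atTop atTop)
    -- the Haar probability measure on `GL_{N+D}(ℤ_p)`, as a left-invariant probability
    -- measure on `Mat_{N+D}(ℤ_p)` concentrated on invertible matrices:
    (H : ∀ N D : ℕ, Measure (Matrix (Fin (N + D)) (Fin (N + D)) ℤ_[p]))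
    (hHprob : ∀ N D, IsProbabilityMeasure (H N D))
    (hHgl : ∀ N D, H N D {M | IsUnit M.det} = 1)
    (hHinv : ∀ N D, ∀ U : (Matrix (Fin (N + D)) (Fin (N + D)) ℤ_[p])ˣ,
      Measure.map (fun M => U.val * M) (H N D) = H N D)
    (c : ℕ → ℕ → ℝ)
    (hc : ∀ N D, c N D = t ^ (-(r N : ℤ)) /
      ∫ M, (if corankTL p N D M ≤ r N then t ^ (-(corankTL p N D M : ℤ)) - 1 else 0)
        ∂(H N D))
    -- the law of a matrix with iid additive-Haar entries: the translation-invariant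
    -- probability measure on `Mat_N(ℤ_p)`:
    (ν : ∀ N : ℕ, Measure (Matrix (Fin N) (Fin N) ℤ_[p]))
    (hνprob : ∀ N, IsProbabilityMeasure (ν N))
    (hνinv : ∀ N, ∀ C : Matrix (Fin N) (Fin N) ℤ_[p],
      Measure.map (fun M => C + M) (ν N) = ν N)
    (c' : ℕ → ℝ)
    (hc' : ∀ N, c' N = t ^ (-(r N : ℤ)) /
      ∫ M, (if N - (M.map PadicInt.toZMod).rank ≤ r N then
        t ^ (-((N - (M.map PadicInt.toZMod).rank : ℕ) : ℤ)) - 1 else 0) ∂(ν N)) :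
    (∀ ε : ℝ, 0 < ε → ∃ N₀ : ℕ, ∀ N, N₀ ≤ N → ∀ D : ℕ, 1 ≤ D →
      |c N D * (1 - t ^ D) * t ^ (r N) - 1| < ε)
    ∧ Tendsto (fun N => c' N * t ^ (r N)) atTop (nhds 1) := by
  have hp : p.Prime := Fact.out
  have hp2 : (2 : ℝ) ≤ p := by exact_mod_cast hp.two_le
  have ht0 : 0 < t := by rw [ht]; positivity
  have ht2 : t ≤ 1 / 2 := by rw [ht]; gcongr
  have htp (m : ℕ) : t ^ m * (p : ℝ) ^ m = 1 := by
    rw [← mul_pow, ht, one_div_mul_cancel (by positivity), one_pow]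
  have hpow (m : ℕ) (hm : 1 ≤ m) : (p : ℝ) ≤ p ^ m := le_self_pow₀ (by linarith) (by omega)
  have htD (D : ℕ) (hD : 1 ≤ D) : t ^ D ≤ 1 / 2 :=
    (pow_le_of_le_one ht0.le (by linarith) (by omega)).trans ht2
  -- the first two moments for a corner of a Haar matrix
  have hcorner (N D : ℕ) (hN : 1 ≤ N) (hD : 1 ≤ D) :
      (1 - t ^ D) * (1 - (t ^ N + 2 * t ^ r N)) ≤
        ∫ M, (if corankTL p N D M ≤ r N then t ^ (-(corankTL p N D M : ℤ)) - 1 else 0) ∂(H N D) ∧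
      ∫ M, (if corankTL p N D M ≤ r N then t ^ (-(corankTL p N D M : ℤ)) - 1 else 0) ∂(H N D) ≤
        1 - t ^ D := by
    have := hHprob N D
    have hmom (k : ℕ) := integral_prod_corank (μ := H N D) (K := ZMod p)
      (A := fun M => (M.submatrix (Fin.castLE (Nat.le_add_right N D))
        (Fin.castLE (Nat.le_add_right N D))).map PadicInt.toZMod)
      (fun S => measurableSet_preimage_map_toZMod
        {B | B.submatrix (Fin.castLE (Nat.le_add_right N D))
          (Fin.castLE (Nat.le_add_right N D)) ∈ S})
      fun (v : Fin k → _) hv => measureReal_corner_mulVec_eq_zero (hHgl N D) (hHinv N D) hv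
    simp only [Nat.card_zmod] at hmom
    have hPN := hpow N hN
    have hPD := hpow D hD
    have hPND : (p : ℝ) ^ (N + D) = p ^ N * p ^ D := pow_add _ _ _
    have h2 : ∫ M, ∏ i ∈ Finset.range 2, ((p : ℝ) ^ corankTL p N D M - (p : ℝ) ^ i) ∂(H N D) ≤ 1 := by
      refine (hmom 2).trans_le ?_
      simp only [Finset.prod_range_succ, Finset.range_zero, Finset.prod_empty, one_mul, pow_zero,
        pow_one, hPND]
      have h1 : ((p : ℝ) ^ N - 1) * (p ^ D - 1) ≤ p ^ N * p ^ D - 1 := by linarith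
      have h3 : ((p : ℝ) ^ N - p) * (p ^ D - p) ≤ p ^ N * p ^ D - p := by nlinarith
      have h4 : 0 ≤ ((p : ℝ) ^ N - 1) * (p ^ D - 1) := mul_nonneg (by linarith) (by linarith)
      have h5 : 0 ≤ ((p : ℝ) ^ N - p) * (p ^ D - p) := mul_nonneg (by linarith) (by linarith)
      rw [mul_div_assoc']
      refine div_le_one_of_le₀ ?_ (mul_nonneg (h4.trans h1) (h5.trans h3))
      calc _ = (((p : ℝ) ^ N - 1) * (p ^ D - 1)) * (((p : ℝ) ^ N - p) * (p ^ D - p)) := by ring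
        _ ≤ _ := mul_le_mul h1 h3 h5 (h4.trans h1)
    have hI := integral_truncated_mem_Icc (N := N) (x := corankTL p N D) hp.two_le (hr1 N)
      (fun S => measurableSet_preimage_map_toZMod {B : Matrix (Fin (N + D)) (Fin (N + D)) (ZMod p) |
        N - (B.submatrix (Fin.castLE (Nat.le_add_right N D))
          (Fin.castLE (Nat.le_add_right N D))).rank ∈ S})
      (fun M => Nat.sub_le N _) h2
    have h1 : ∫ M, ∏ i ∈ Finset.range 1, ((p : ℝ) ^ corankTL p N D M - (p : ℝ) ^ i) ∂(H N D) =
        (1 - t ^ D) * ((1 - t ^ N) / (1 - t ^ (N + D))) := by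
      refine (hmom 1).trans ?_
      have e (m : ℕ) : (p : ℝ) ^ m - 1 = p ^ m * (1 - t ^ m) := by linarith [htp m]
      simp only [Finset.prod_range_succ, Finset.range_zero, Finset.prod_empty, one_mul, pow_zero, e]
      have hne := htD (N + D) (by omega)
      have hne' : 1 - t ^ (N + D) ≠ 0 := by linarith
      have hp0 : (p : ℝ) ^ (N + D) ≠ 0 := by positivity
      field_simp
      rw [hPND]
      ring
    rw [h1, ← ht] at hI
    have hDhalf := htD D hD
    have hNhalf := htD N hN
    have hNDhalf := htD (N + D) (by omega)
    have htN : 0 < t ^ N := pow_pos ht0 _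
    have htND : 0 < t ^ (N + D) := pow_pos ht0 _
    have htr : 0 < t ^ r N := pow_pos ht0 _
    have hND : t ^ (N + D) ≤ t ^ N := pow_le_pow_of_le_one ht0.le (by linarith) (by omega)
    have hq1 : (1 - t ^ N) / (1 - t ^ (N + D)) ≤ 1 :=
      div_le_one_of_le₀ (by linarith) (by linarith)
    have hq2 : 1 - t ^ N ≤ (1 - t ^ N) / (1 - t ^ (N + D)) := by
      rw [le_div_iff₀ (by linarith)]
      nlinarith
    constructor
    · refine le_trans ?_ hI.1
      nlinarith
    · refine hI.2.trans ?_
      nlinarith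
  have hiid (N : ℕ) (hN : 1 ≤ N) :
      1 - (t ^ N + 2 * t ^ r N) ≤
        ∫ M, (if N - (M.map PadicInt.toZMod).rank ≤ r N then
          t ^ (-((N - (M.map PadicInt.toZMod).rank : ℕ) : ℤ)) - 1 else 0) ∂(ν N) ∧
      ∫ M, (if N - (M.map PadicInt.toZMod).rank ≤ r N then
          t ^ (-((N - (M.map PadicInt.toZMod).rank : ℕ) : ℤ)) - 1 else 0) ∂(ν N) ≤ 1 := by
    have := hνprob N
    have hmom (k : ℕ) := integral_prod_corank (μ := ν N) (K := ZMod p)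
      (A := fun M => M.map PadicInt.toZMod) measurableSet_preimage_map_toZMod
      fun (v : Fin k → _) hv => measureReal_mulVec_eq_zero_of_add_invariant (hνinv N) hv
    simp only [Nat.card_zmod] at hmom
    have hPN := hpow N hN
    have h2 := hmom 2
    have h1 := hmom 1
    simp only [Finset.prod_range_one, pow_zero, mul_one] at h1
    have h2' : (∏ i ∈ Finset.range 2, ((p : ℝ) ^ N - (p : ℝ) ^ i)) * (1 / (p : ℝ) ^ (N * 2)) ≤ 1 := by
      simp only [Finset.prod_range_succ, Finset.range_zero, Finset.prod_empty, one_mul, pow_zero,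
        pow_one, mul_one_div]
      refine div_le_one_of_le₀ ?_ (by positivity)
      rw [pow_mul]
      nlinarith
    have hI := integral_truncated_mem_Icc (μ := ν N) (N := N) hp.two_le (hr1 N)
      (x := fun M => N - (M.map PadicInt.toZMod).rank)
      (fun S => measurableSet_preimage_map_toZMod {B : Matrix (Fin N) (Fin N) (ZMod p) |
        N - B.rank ∈ S})
      (fun M => Nat.sub_le N _) (h2.trans_le h2')
    simp only [Finset.prod_range_one, pow_zero] at hI
    rw [h1, ← ht] at hI
    have e : ((p : ℝ) ^ N - 1) * (1 / p ^ N) = 1 - t ^ N := by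
      rw [ht, one_div_pow]; field_simp
    rw [e] at hI
    have htN : 0 < t ^ N := pow_pos ht0 _
    have htr : 0 < t ^ r N := pow_pos ht0 _
    exact ⟨by linarith [hI.1], by linarith [hI.2]⟩
  have hs : Tendsto (fun N => t ^ N + 2 * t ^ r N) atTop (nhds 0) := by
    have h := tendsto_pow_atTop_nhds_zero_of_lt_one ht0.le (by linarith : t < 1)
    simpa using h.add ((h.comp hr).const_mul 2)
  have hinv : Tendsto (fun N => 1 / (1 - (t ^ N + 2 * t ^ r N))) atTop (nhds 1) := by
    simpa using (hs.const_sub 1).inv₀ (by simp)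
  have hev (ε : ℝ) (hε : 0 < ε) : ∀ᶠ N in atTop, 1 ≤ N ∧ t ^ N + 2 * t ^ r N < 1 ∧
      1 / (1 - (t ^ N + 2 * t ^ r N)) < 1 + ε :=
    (eventually_ge_atTop 1).and ((hs.eventually_lt_const one_pos).and
      (hinv.eventually_lt_const (by linarith)))
  have htt (m : ℕ) : t ^ (-(m : ℤ)) * t ^ m = 1 := by
    rw [zpow_neg, zpow_natCast, inv_mul_cancel₀ (pow_pos ht0 m).ne']
  constructor
  · intro ε hε
    obtain ⟨N₀, hN₀⟩ := eventually_atTop.1 (hev ε hε)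
    refine ⟨N₀, fun N hN D hD => ?_⟩
    obtain ⟨hN1, hlt, hdiv⟩ := hN₀ N hN
    obtain ⟨hlow, hup⟩ := hcorner N D hN1 hD
    rw [hc, div_mul_eq_mul_div, div_mul_eq_mul_div, mul_right_comm, htt, one_mul]
    exact abs_div_sub_one_lt (by linarith [htD D hD]) hlow hup hlt hdiv
  · rw [Metric.tendsto_nhds]
    intro ε hε
    filter_upwards [hev ε hε] with N ⟨hN1, hlt, hdiv⟩
    obtain ⟨hlow, hup⟩ := hiid N hN1
    rw [Real.dist_eq, hc', div_mul_eq_mul_div, htt]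
    exact abs_div_sub_one_lt one_pos (by linarith) hup hlt hdiv
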